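/- arXiv:1507.07089 — 6 statements merged into one kernel-verified Lean document; each statement's English description precedes it below -/
import Mathlib

section
/- For every differentiable convex function F : (Fin n → ℝ) → ℝ, every probability vector (t_1, …, t_ℓ), every family of points s_1, …, s_ℓ and every point s̃ in Fin n → ℝ, writing ŝ = ∑ t_i · s_i, one has ∑ t_i · D_F(s_i, s̃) ≥ ∑ t_i · D_F(s_i, ŝ); that is, the expected Bregman divergence Q ↦ ∑ t_i · D_F(s_i, Q) is minimized at Q = ŝ. -/
/-- The Bregman divergence of a differentiable function `F`:
`D_F(p,q) = F(p) - F(q) - ⟨∇F(q), p - q⟩`. -/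
noncomputable def bregman {n : ℕ} (F : (Fin n → ℝ) → ℝ) (p q : Fin n → ℝ) : ℝ :=
  F p - F q - fderiv ℝ F q (p - q)

/-- A convex function lies above its tangent hyperplanes. -/
theorem ConvexOn.fderiv_sub_le {E : Type*} [NormedAddCommGroup E] [NormedSpace ℝ E] {F : E → ℝ}
    (hconv : ConvexOn ℝ Set.univ F) {q : E} (hdiff : DifferentiableAt ℝ F q) (p : E) :
    fderiv ℝ F q (p - q) ≤ F p - F q := by
  have hline : ConvexOn ℝ Set.univ (F ∘ AffineMap.lineMap (k := ℝ) q p) :=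
    hconv.comp_affineMap _
  have hderiv : HasDerivAt (F ∘ AffineMap.lineMap (k := ℝ) q p) (fderiv ℝ F q (p - q)) 0 := by
    refine HasFDerivAt.comp_hasDerivAt 0 ?_ AffineMap.hasDerivAt_lineMap
    simpa using hdiff.hasFDerivAt
  simpa [slope_def_field] using
    hline.le_slope_of_hasDerivAt (Set.mem_univ 0) (Set.mem_univ 1) zero_lt_one hderiv

/-- The expected Bregman divergence depends on the points only through the mean of `F` and the
mean of the points. -/
theorem sum_mul_bregman {n : ℕ} {ι : Type*} [Fintype ι] (F : (Fin n → ℝ) → ℝ) (t : ι → ℝ)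
    (ht : ∑ i, t i = 1) (s : ι → Fin n → ℝ) (q : Fin n → ℝ) :
    ∑ i, t i * bregman F (s i) q =
      ∑ i, t i * F (s i) - F q - fderiv ℝ F q (∑ i, t i • s i - q) := by
  simp only [bregman, map_sub, map_sum, map_smul, smul_eq_mul, mul_sub, Finset.sum_sub_distrib,
    ← Finset.sum_mul, ht, one_mul]

theorem bregman_expected_divergence_minimized_at_mean {n ℓ : ℕ} (F : (Fin n → ℝ) → ℝ)
    (hdiff : Differentiable ℝ F) (hconv : ConvexOn ℝ Set.univ F)
    (t : Fin ℓ → ℝ) (ht0 : ∀ i, 0 ≤ t i) (ht1 : ∑ i, t i = 1)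
    (s : Fin ℓ → (Fin n → ℝ)) (stilde : Fin n → ℝ) :
    ∑ i, t i * bregman F (s i) (∑ i, t i • s i) ≤ ∑ i, t i * bregman F (s i) stilde := by
  rw [sum_mul_bregman F t ht1, sum_mul_bregman F t ht1, sub_self, map_zero]
  linarith [hconv.fderiv_sub_le (hdiff stilde) (∑ i, t i • s i)]
end

section
/- Let F₁, F₂ : (Fin n → ℝ) → ℝ be differentiable functions. Then D_{F₁}(p, q) = D_{F₂}(p, q) for all p, q if and only if F₁ − F₂ is an affine function, i.e. there exist a linear functional L on Fin n → ℝ and a constant c ∈ ℝ with F₁(p) − F₂(p) = L(p) + c for all p. -/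
theorem bregman_eq_iff_affine_difference {n : ℕ} (F₁ F₂ : (Fin n → ℝ) → ℝ)
    (h₁ : Differentiable ℝ F₁) (h₂ : Differentiable ℝ F₂) :
    (∀ p q : Fin n → ℝ, bregman F₁ p q = bregman F₂ p q) ↔
      ∃ (L : (Fin n → ℝ) →ₗ[ℝ] ℝ) (c : ℝ), ∀ p : Fin n → ℝ, F₁ p - F₂ p = L p + c := by
  constructor
  · intro h
    refine ⟨(fderiv ℝ F₁ 0 - fderiv ℝ F₂ 0).toLinearMap, F₁ 0 - F₂ 0, fun p => ?_⟩
    have hp := h p 0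
    simp only [bregman, sub_zero] at hp
    simp only [ContinuousLinearMap.coe_coe, sub_apply]
    linarith
  · rintro ⟨L, c, hL⟩ p q
    have hd : fderiv ℝ F₁ q - fderiv ℝ F₂ q = L.toContinuousLinearMap := by
      have hF : F₁ - F₂ = fun x => L.toContinuousLinearMap x + c := funext hL
      rw [← fderiv_sub (h₁ q) (h₂ q), hF, fderiv_add_const, ContinuousLinearMap.fderiv]
    have hpq : fderiv ℝ F₁ q (p - q) - fderiv ℝ F₂ q (p - q) = L p - L q := by
      rw [← sub_apply, hd, LinearMap.coe_toContinuousLinearMap', map_sub]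
    have hp := hL p
    have hq := hL q
    simp only [bregman]
    linarith
end

section
/- Let F : (Fin n → ℝ) → ℝ be a differentiable strictly convex function and g : Fin n → ℝ an arbitrary function, and define the scoring rule f(x, Q) = D_F(δ_x, Q) + g(x), where δ_x is the point mass at x. Then f is proper: for all P, Q ∈ Δ_n, ∑_x P(x)·f(x, P) ≤ ∑_x P(x)·f(x, Q), with equality only if Q = P. -/
/-- The probability simplex on `Fin n`. -/
def simplex (n : ℕ) : Set (Fin n → ℝ) :=
  {p | (∀ i, 0 ≤ p i) ∧ ∑ i, p i = 1}

/-- The point mass at `x : Fin n`. -/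
def pointMass {n : ℕ} (x : Fin n) : Fin n → ℝ :=
  fun i => if i = x then 1 else 0

theorem StrictConvexOn.comp_lineMap {E : Type*} [AddCommGroup E] [Module ℝ E] {F : E → ℝ}
    (hF : StrictConvexOn ℝ Set.univ F) {p q : E} (hpq : p ≠ q) :
    StrictConvexOn ℝ Set.univ (F ∘ AffineMap.lineMap (k := ℝ) q p) := by
  refine ⟨convex_univ, fun s _ t _ hst a b ha hb hab => ?_⟩
  have hne : AffineMap.lineMap q p s ≠ AffineMap.lineMap q p t :=
    (AffineMap.lineMap_injective ℝ hpq.symm).ne hst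
  simpa only [Function.comp_apply, Convex.combo_affine_apply hab] using
    hF.2 (Set.mem_univ _) (Set.mem_univ _) hne ha hb hab

theorem bregman_self {n : ℕ} (F : (Fin n → ℝ) → ℝ) (p : Fin n → ℝ) : bregman F p p = 0 := by
  simp [bregman]

theorem bregman_pos {n : ℕ} {F : (Fin n → ℝ) → ℝ} {p q : Fin n → ℝ}
    (hdiff : DifferentiableAt ℝ F q) (hconv : StrictConvexOn ℝ Set.univ F) (hpq : p ≠ q) :
    0 < bregman F p q := by
  have hderiv : HasDerivAt (F ∘ AffineMap.lineMap (k := ℝ) q p) (fderiv ℝ F q (p - q)) 0 :=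
    HasFDerivAt.comp_hasDerivAt_of_eq 0 hdiff.hasFDerivAt AffineMap.hasDerivAt_lineMap (by simp)
  have hslope := (hconv.comp_lineMap hpq).lt_slope_of_hasDerivAt
    (Set.mem_univ 0) (Set.mem_univ 1) zero_lt_one hderiv
  simp only [slope_def_field, Function.comp_apply, AffineMap.lineMap_apply_one,
    AffineMap.lineMap_apply_zero, sub_zero, div_one] at hslope
  simpa [bregman] using hslope

theorem sum_smul_pointMass {n : ℕ} (p : Fin n → ℝ) : ∑ x, p x • pointMass x = p := by
  ext i
  simp [pointMass, Finset.sum_apply]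

/-- The expected Bregman divergence from the point masses splits into a term independent of the
forecast `q` and the divergence of `p` from `q`. -/
theorem sum_mul_bregman_pointMass {n : ℕ} (F : (Fin n → ℝ) → ℝ) {p : Fin n → ℝ}
    (hp : ∑ x, p x = 1) (q : Fin n → ℝ) :
    ∑ x, p x * bregman F (pointMass x) q = ∑ x, p x * F (pointMass x) - F p + bregman F p q := by
  have hlin : ∑ x, p x * fderiv ℝ F q (pointMass x) = fderiv ℝ F q p := by
    conv_rhs => rw [← sum_smul_pointMass p]
    simp
  simp only [bregman, map_sub, mul_sub, Finset.sum_sub_distrib, ← Finset.sum_mul, hp, hlin]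
  ring

theorem bregman_scoring_rule_is_proper {n : ℕ} (F : (Fin n → ℝ) → ℝ)
    (hdiff : Differentiable ℝ F) (hconv : StrictConvexOn ℝ Set.univ F)
    (g : Fin n → ℝ)
    (f : Fin n → (Fin n → ℝ) → ℝ)
    (hf : ∀ x Q, f x Q = bregman F (pointMass x) Q + g x) :
    ∀ P ∈ simplex n, ∀ Q ∈ simplex n,
      (∑ x, P x * f x P ≤ ∑ x, P x * f x Q) ∧
        (∑ x, P x * f x P = ∑ x, P x * f x Q → Q = P) := by
  intro P hP Q _
  have hscore : ∀ R, ∑ x, P x * f x R =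
      ∑ x, P x * F (pointMass x) - F P + bregman F P R + ∑ x, P x * g x := fun R => by
    simp only [hf, mul_add, Finset.sum_add_distrib, sum_mul_bregman_pointMass F hP.2]
  rw [hscore P, hscore Q, bregman_self]
  rcases eq_or_ne P Q with rfl | hne
  · simp [bregman_self]
  · have hpos := bregman_pos (hdiff Q) hconv hne
    exact ⟨by linarith, fun h => by linarith⟩
end

section
/- Let n ≥ 2, let F : (Fin n → ℝ) → ℝ be differentiable, and suppose the Bregman divergence D_F satisfies the sufficiency property on Δ_n. Then for every i ∈ Fin n and every q ∈ Δ_n, D_F(δ_i, q) = D_F(δ_1, (q_i, (1−q_i)/(n−1), …, (1−q_i)/(n−1))), i.e. D_F(δ_i, q) equals the value of D_F at the point mass at the first coordinate against the distribution with mass q_i on the first coordinate and the remaining mass spread uniformly on the other n−1 coordinates. -/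
/-- A (column-)stochastic matrix: nonnegative entries, each column sums to `1`. -/
def IsStochastic {n : ℕ} (Φ : Fin n → Fin n → ℝ) : Prop :=
  (∀ i j, 0 ≤ Φ i j) ∧ ∀ j, ∑ i, Φ i j = 1

/-- The action of a stochastic matrix on a probability vector. -/
def stApply {n : ℕ} (Φ : Fin n → Fin n → ℝ) (p : Fin n → ℝ) : Fin n → ℝ :=
  fun i => ∑ j, Φ i j * p j

/-- A divergence `D` on the simplex satisfies the sufficiency property if
`D (Φp) (Φq) = D p q` for every stochastic matrix `Φ` that can be reversed on
`{p, q}` by some stochastic matrix `Ψ`. -/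
def SufficiencyProperty {n : ℕ} (D : (Fin n → ℝ) → (Fin n → ℝ) → ℝ) : Prop :=
  ∀ p ∈ simplex n, ∀ q ∈ simplex n, ∀ Φ : Fin n → Fin n → ℝ, IsStochastic Φ →
    (∃ Ψ : Fin n → Fin n → ℝ, IsStochastic Ψ ∧
      stApply Ψ (stApply Φ p) = p ∧ stApply Ψ (stApply Φ q) = q) →
    D (stApply Φ p) (stApply Φ q) = D p q

/-- The matrix whose column at `x` is `u` and whose other columns are all `v`. -/
def twoColumn {n : ℕ} (x : Fin n) (u v : Fin n → ℝ) : Fin n → Fin n → ℝ :=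
  fun a b => if b = x then u a else v a

theorem isStochastic_twoColumn {n : ℕ} (x : Fin n) {u v : Fin n → ℝ}
    (hu : u ∈ simplex n) (hv : v ∈ simplex n) : IsStochastic (twoColumn x u v) := by
  refine ⟨fun a b => ?_, fun b => ?_⟩
  · unfold twoColumn
    split_ifs
    exacts [hu.1 a, hv.1 a]
  · unfold twoColumn
    split_ifs
    exacts [hu.2, hv.2]

theorem stApply_twoColumn {n : ℕ} (x : Fin n) (u v : Fin n → ℝ) {p : Fin n → ℝ}
    (hp : ∑ j, p j = 1) (a : Fin n) :
    stApply (twoColumn x u v) p a = p x * u a + (1 - p x) * v a := by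
  have h (b : Fin n) : twoColumn x u v a b * p b =
      v a * p b + if b = x then (u a - v a) * p b else 0 := by
    unfold twoColumn
    split_ifs <;> ring
  simp only [stApply, h, Finset.sum_add_distrib, ← Finset.mul_sum, hp, Finset.sum_ite_eq',
    Finset.mem_univ, if_true]
  ring

theorem pointMass_mem_simplex {n : ℕ} (x : Fin n) : pointMass x ∈ simplex n := by
  refine ⟨fun i => ?_, by simp [pointMass]⟩
  unfold pointMass
  split_ifs <;> norm_num

theorem stApply_mem_simplex {n : ℕ} {Φ : Fin n → Fin n → ℝ} (hΦ : IsStochastic Φ)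
    {p : Fin n → ℝ} (hp : p ∈ simplex n) : stApply Φ p ∈ simplex n := by
  refine ⟨fun i => Finset.sum_nonneg fun j _ => mul_nonneg (hΦ.1 i j) (hp.1 j), ?_⟩
  simp only [stApply]
  rw [Finset.sum_comm]
  simp only [← Finset.sum_mul, hΦ.2, one_mul, hp.2]

theorem stApply_twoColumn_pointMass {n : ℕ} (x : Fin n) (u v : Fin n → ℝ) :
    stApply (twoColumn x u v) (pointMass x) = u := by
  funext a
  rw [stApply_twoColumn x u v (pointMass_mem_simplex x).2]
  simp [pointMass]

/-- Conditioning a distribution on the complement of `x`. -/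
theorem condition_compl_mem_simplex {n : ℕ} {q : Fin n → ℝ} (hq : q ∈ simplex n) {x : Fin n}
    (hx : q x < 1) : (fun j => if j = x then 0 else q j / (1 - q x)) ∈ simplex n := by
  refine ⟨fun j => ?_, ?_⟩
  · dsimp only
    split_ifs
    exacts [le_rfl, div_nonneg (hq.1 j) (sub_pos.2 hx).le]
  · have h (j : Fin n) : (if j = x then 0 else q j / (1 - q x)) =
        q j / (1 - q x) - if j = x then q j / (1 - q x) else 0 := by
      split_ifs <;> ring
    simp only [h, Finset.sum_sub_distrib, ← Finset.sum_div, hq.2, Finset.sum_ite_eq',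
      Finset.mem_univ, if_true]
    rw [← sub_div, div_self (sub_pos.2 hx).ne']

/-- The uniform distribution on the complement of `x`. -/
theorem uniform_compl_mem_simplex {n : ℕ} (hn : 2 ≤ n) (x : Fin n) :
    (fun j => if j = x then 0 else 1 / ((n : ℝ) - 1)) ∈ simplex n := by
  have hn' : (0 : ℝ) < (n : ℝ) - 1 := by
    have : (2 : ℝ) ≤ n := by exact_mod_cast hn
    linarith
  refine ⟨fun j => ?_, ?_⟩
  · dsimp only
    split_ifs
    exacts [le_rfl, by positivity]
  · have h (j : Fin n) : (if j = x then 0 else 1 / ((n : ℝ) - 1)) =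
        1 / ((n : ℝ) - 1) - if j = x then 1 / ((n : ℝ) - 1) else 0 := by
      split_ifs <;> ring
    simp only [h, Finset.sum_sub_distrib, Finset.sum_const, Finset.card_univ, Fintype.card_fin,
      nsmul_eq_mul, Finset.sum_ite_eq', Finset.mem_univ, if_true]
    field_simp

theorem eq_pointMass_of_apply_eq_one {n : ℕ} {q : Fin n → ℝ} (hq : q ∈ simplex n) {x : Fin n}
    (hx : q x = 1) : q = pointMass x := by
  funext j
  by_cases hj : j = x
  · simp [pointMass, hj, hx]
  · have hsum := Finset.add_sum_erase Finset.univ q (Finset.mem_univ x)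
    have hle := Finset.single_le_sum (fun k _ => hq.1 k)
      (Finset.mem_erase.2 ⟨hj, Finset.mem_univ j⟩)
    rw [hq.2, hx] at hsum
    simp only [pointMass, hj, if_false]
    linarith [hq.1 j]

theorem bregman_sufficiency_reduce_to_first_coordinate {n : ℕ} (hn : 2 ≤ n)
    (F : (Fin n → ℝ) → ℝ)
    (hdiff : Differentiable ℝ F) (hsuff : SufficiencyProperty (bregman F)) :
    ∀ (i : Fin n), ∀ q ∈ simplex n,
      bregman F (pointMass i) q =
        bregman F (pointMass (⟨0, by omega⟩ : Fin n))
          (fun j => if j = (⟨0, by omega⟩ : Fin n) then q i else (1 - q i) / ((n : ℝ) - 1)) := by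
  intro i q hq
  generalize (⟨0, by omega⟩ : Fin n) = o
  have hle : q i ≤ 1 := hq.2 ▸ Finset.single_le_sum (fun k _ => hq.1 k) (Finset.mem_univ i)
  rcases hle.eq_or_lt with hi | hi
  · have hr : (fun j => if j = o then q i else (1 - q i) / ((n : ℝ) - 1)) = pointMass o := by
      funext j
      simp [pointMass, hi]
    rw [hr, eq_pointMass_of_apply_eq_one hq hi, bregman_self, bregman_self]
  · set v : Fin n → ℝ := fun j => if j = o then 0 else 1 / ((n : ℝ) - 1) with hv
    set w : Fin n → ℝ := fun j => if j = i then 0 else q j / (1 - q i) with hw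
    have hΦ : IsStochastic (twoColumn i (pointMass o) v) :=
      isStochastic_twoColumn i (pointMass_mem_simplex o) (uniform_compl_mem_simplex hn o)
    have hΨ : IsStochastic (twoColumn o (pointMass i) w) :=
      isStochastic_twoColumn o (pointMass_mem_simplex i) (condition_compl_mem_simplex hq hi)
    have hΦq : stApply (twoColumn i (pointMass o) v) q =
        fun j => if j = o then q i else (1 - q i) / ((n : ℝ) - 1) := by
      funext j
      rw [stApply_twoColumn i _ _ hq.2]
      by_cases hj : j = o <;> simp [pointMass, hv, hj, div_eq_mul_inv]
    have hΨq : stApply (twoColumn o (pointMass i) w)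
        (stApply (twoColumn i (pointMass o) v) q) = q := by
      funext j
      rw [stApply_twoColumn o _ _ (stApply_mem_simplex hΦ hq).2, hΦq]
      by_cases hj : j = i
      · simp [pointMass, hw, hj]
      · simp [pointMass, hw, hj, mul_div_cancel₀ _ (sub_pos.2 hi).ne']
    have h := hsuff _ (pointMass_mem_simplex i) q hq _ hΦ
      ⟨_, hΨ, by rw [stApply_twoColumn_pointMass, stApply_twoColumn_pointMass], hΨq⟩
    rw [stApply_twoColumn_pointMass, hΦq] at h
    exact h.symm
end

section
/- Information divergence satisfies the data processing inequality on a finite alphabet: for every stochastic matrix Φ and all p, q ∈ Δ_n such that p, q, Φp and Φq have strictly positive entries, D(Φp‖Φq) ≤ D(p‖q). -/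
/-- Information divergence (KL divergence) on the finite alphabet `Fin n`. -/
noncomputable def KL {n : ℕ} (p q : Fin n → ℝ) : ℝ :=
  ∑ i, p i * Real.log (p i / q i)

/-- The weighted log-sum inequality. -/
theorem weighted_log_sum_inequality {ι : Type*} (s : Finset ι) (w p q : ι → ℝ)
    (hw : ∀ j ∈ s, 0 ≤ w j) (hp : ∀ j ∈ s, 0 < p j) (hq : ∀ j ∈ s, 0 < q j)
    (hwp : 0 < ∑ j ∈ s, w j * p j) (hwq : 0 < ∑ j ∈ s, w j * q j) :
    (∑ j ∈ s, w j * p j) * Real.log ((∑ j ∈ s, w j * p j) / ∑ j ∈ s, w j * q j) ≤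
      ∑ j ∈ s, w j * (p j * Real.log (p j / q j)) := by
  set A := ∑ j ∈ s, w j * p j with hA
  set B := ∑ j ∈ s, w j * q j with hB
  have tangent : ∀ j ∈ s, w j * p j * Real.log (A / B) + (w j * p j - w j * q j * (A / B)) ≤
      w j * (p j * Real.log (p j / q j)) := by
    intro j hj
    have hpj := hp j hj
    have hqj := hq j hj
    have hlog := Real.log_le_sub_one_of_pos (div_pos (div_pos hwp hwq) (div_pos hpj hqj))
    rw [Real.log_div (div_pos hwp hwq).ne' (div_pos hpj hqj).ne'] at hlog
    have hmul := mul_le_mul_of_nonneg_left hlog (mul_nonneg (hw j hj) hpj.le)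
    have hcancel : w j * p j * (A / B / (p j / q j) - 1) =
        w j * q j * (A / B) - w j * p j := by
      field_simp
    linarith
  calc A * Real.log (A / B)
      = ∑ j ∈ s, (w j * p j * Real.log (A / B) + (w j * p j - w j * q j * (A / B))) := by
        rw [Finset.sum_add_distrib, Finset.sum_sub_distrib, ← Finset.sum_mul, ← Finset.sum_mul,
          ← hA, ← hB, mul_div_cancel₀ A hwq.ne', sub_self, add_zero]
    _ ≤ _ := Finset.sum_le_sum tangent

theorem KL_data_processing_inequality {n : ℕ} (Φ : Fin n → Fin n → ℝ)
    (hΦ : IsStochastic Φ) :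
    ∀ p ∈ simplex n, ∀ q ∈ simplex n,
      (∀ i, 0 < p i) → (∀ i, 0 < q i) →
      (∀ i, 0 < stApply Φ p i) → (∀ i, 0 < stApply Φ q i) →
      KL (stApply Φ p) (stApply Φ q) ≤ KL p q := by
  intro p _ q _ hp hq hΦp hΦq
  calc KL (stApply Φ p) (stApply Φ q)
      ≤ ∑ i, ∑ j, Φ i j * (p j * Real.log (p j / q j)) :=
        Finset.sum_le_sum fun i _ => weighted_log_sum_inequality Finset.univ (Φ i) p q
          (fun j _ => hΦ.1 i j) (fun j _ => hp j) (fun j _ => hq j) (hΦp i) (hΦq i)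
    _ = KL p q := by
        rw [Finset.sum_comm]
        simp only [← Finset.sum_mul, hΦ.2, one_mul, KL]
end

section
/- Information divergence satisfies the sufficiency property on a finite alphabet: for all p, q ∈ Δ_n with strictly positive entries and every stochastic matrix Φ such that Φp and Φq have strictly positive entries and there exists a stochastic matrix Ψ with Ψ(Φp) = p and Ψ(Φq) = q, one has D(Φp‖Φq) = D(p‖q). -/
/-- The log sum inequality, applied to one output letter of a stochastic matrix. -/
theorem stApply_mul_log_le {n : ℕ} {Φ : Fin n → Fin n → ℝ} (hΦ : IsStochastic Φ)
    {p q : Fin n → ℝ} (hp : ∀ i, 0 < p i) (hq : ∀ i, 0 < q i) {i : Fin n}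
    (hP : 0 < stApply Φ p i) (hQ : 0 < stApply Φ q i) :
    stApply Φ p i * Real.log (stApply Φ p i / stApply Φ q i) ≤
      ∑ j, Φ i j * (p j * Real.log (p j / q j)) := by
  set P := stApply Φ p i
  set Q := stApply Φ q i
  have hterm : ∀ j, Φ i j * p j * Real.log (P / Q) + (Φ i j * p j - Φ i j * q j * (P / Q)) ≤
      Φ i j * (p j * Real.log (p j / q j)) := by
    intro j
    have hlog := Real.one_sub_inv_le_log_of_pos
      (div_pos (div_pos (hp j) (hq j)) (div_pos hP hQ))
    rw [Real.log_div (div_pos (hp j) (hq j)).ne' (div_pos hP hQ).ne'] at hlog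
    have hmul := mul_le_mul_of_nonneg_left hlog (mul_nonneg (hΦ.1 i j) (hp j).le)
    have hexpand : Φ i j * p j * (1 - (p j / q j / (P / Q))⁻¹) =
        Φ i j * p j - Φ i j * q j * (P / Q) := by
      have := (hp j).ne'
      have := (hq j).ne'
      field_simp
    linarith
  have hsum := Finset.sum_le_sum fun j (_ : j ∈ Finset.univ) => hterm j
  rw [Finset.sum_add_distrib, Finset.sum_sub_distrib, ← Finset.sum_mul, ← Finset.sum_mul] at hsum
  change P * Real.log (P / Q) + (P - Q * (P / Q)) ≤ _ at hsum
  rwa [mul_div_cancel₀ P hQ.ne', sub_self, add_zero] at hsum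

/-- The data processing inequality for information divergence. -/
theorem KL_stApply_le {n : ℕ} {Φ : Fin n → Fin n → ℝ} (hΦ : IsStochastic Φ)
    {p q : Fin n → ℝ} (hp : ∀ i, 0 < p i) (hq : ∀ i, 0 < q i)
    (hP : ∀ i, 0 < stApply Φ p i) (hQ : ∀ i, 0 < stApply Φ q i) :
    KL (stApply Φ p) (stApply Φ q) ≤ KL p q := by
  refine (Finset.sum_le_sum fun i _ => stApply_mul_log_le hΦ hp hq (hP i) (hQ i)).trans_eq ?_
  rw [Finset.sum_comm]
  simp only [← Finset.sum_mul, hΦ.2, one_mul, KL]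

theorem KL_sufficiency_property {n : ℕ} :
    ∀ p ∈ simplex n, ∀ q ∈ simplex n,
      (∀ i, 0 < p i) → (∀ i, 0 < q i) →
      ∀ Φ : Fin n → Fin n → ℝ, IsStochastic Φ →
        (∀ i, 0 < stApply Φ p i) → (∀ i, 0 < stApply Φ q i) →
        (∃ Ψ : Fin n → Fin n → ℝ, IsStochastic Ψ ∧
          stApply Ψ (stApply Φ p) = p ∧ stApply Ψ (stApply Φ q) = q) →
        KL (stApply Φ p) (stApply Φ q) = KL p q := by
  rintro p - q - hp hq Φ hΦ hP hQ ⟨Ψ, hΨ, hΨp, hΨq⟩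
  refine le_antisymm (KL_stApply_le hΦ hp hq hP hQ) ?_
  have h := KL_stApply_le hΨ hP hQ (by rwa [hΨp]) (by rwa [hΨq])
  rwa [hΨp, hΨq] at h
end
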